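/- arXiv:1305.4289 — 2 statements merged into one kernel-verified Lean document; each statement's English description precedes it below -/
import Mathlib

section
/- Let d ≥ 1 be an integer. For every n ≥ 1 and all real symmetric n×n matrices X and Y with X ⪰ 0, the following are equivalent: (i) X^{1/(2d)} ⪰ Y ⪰ 0; (ii) there exists a real symmetric n×n matrix W with W ⪰ 0 such that X ⪰ W² and W^{1/d} ⪰ Y ⪰ 0; (iii) there exists a real symmetric n×n matrix W with W ⪰ 0 such that the block matrix [[X, W],[W, I_n]] is positive semidefinite and W^{1/d} ⪰ Y ⪰ 0. -/
open Matrix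

/-- The power `X^p` of a real symmetric matrix, defined via the spectral
decomposition (powers of the eigenvalues). -/
noncomputable def symPow {n : ℕ} (X : Matrix (Fin n) (Fin n) ℝ) (p : ℝ) :
    Matrix (Fin n) (Fin n) ℝ :=
  if hX : X.IsHermitian then
    (hX.eigenvectorUnitary : Matrix (Fin n) (Fin n) ℝ) *
      Matrix.diagonal (fun i => hX.eigenvalues i ^ p) *
      (star (hX.eigenvectorUnitary : Matrix (Fin n) (Fin n) ℝ))
  else 0

open scoped ComplexOrder MatrixOrder Matrix.Norms.L2Operator

/-- The entrywise inclusion of real matrices into complex matrices as a star-algebra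
homomorphism. -/
noncomputable def Matrix.complexify (n : Type*) [Fintype n] [DecidableEq n] :
    Matrix n n ℝ →⋆ₐ[ℝ] Matrix n n ℂ :=
  { Complex.ofRealAm.mapMatrix with
    map_star' := fun A => by
      ext i j
      simp [Matrix.star_apply] }

namespace Matrix

variable {n : Type*} [Fintype n] [DecidableEq n]

lemma complexify_apply (A : Matrix n n ℝ) (i j : n) :
    complexify n A i j = (A i j : ℂ) := rfl

lemma continuous_complexify : Continuous (complexify n) :=
  (Continuous.matrix_map continuous_id Complex.continuous_ofReal :
    Continuous fun A : Matrix n n ℝ => A.map Complex.ofReal)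

lemma complexify_nonneg_iff {A : Matrix n n ℝ} : 0 ≤ complexify n A ↔ 0 ≤ A := by
  refine ⟨fun h => ?_, fun h => map_nonneg (complexify n) h⟩
  rw [nonneg_iff_posSemidef] at h ⊢
  refine .of_dotProduct_mulVec_nonneg ?_ fun x => ?_
  · ext i j
    have := congr_fun₂ h.1 i j
    simpa [complexify_apply, Matrix.conjTranspose_apply] using this
  · have hx := h.dotProduct_mulVec_nonneg (fun i => (x i : ℂ))
    have : star (fun i => (x i : ℂ)) ⬝ᵥ (complexify n A *ᵥ fun i => (x i : ℂ)) =
        ((star x ⬝ᵥ (A *ᵥ x) : ℝ) : ℂ) := by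
      simp [dotProduct, mulVec, complexify_apply]
    rw [this] at hx
    exact_mod_cast hx

/-- The **Löwner–Heinz theorem** for real matrices. -/
theorem rpow_le_rpow_of_le {A B : Matrix n n ℝ} {p : ℝ} (hp : p ∈ Set.Icc (0 : ℝ) 1)
    (hA : 0 ≤ A) (hAB : A ≤ B) : A ^ p ≤ B ^ p := by
  have map_rpow : ∀ C : Matrix n n ℝ, 0 ≤ C → complexify n (C ^ p) = complexify n C ^ p := by
    intro C hC
    have hC' : 0 ≤ complexify n C := complexify_nonneg_iff.2 hC
    rw [CFC.rpow_eq_cfc_real hC, CFC.rpow_eq_cfc_real hC']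
    exact StarAlgHomClass.map_cfc (complexify n) (fun x : ℝ => x ^ p) C
      (Real.continuous_rpow_const hp.1).continuousOn continuous_complexify
      (IsSelfAdjoint.of_nonneg hC) (IsSelfAdjoint.of_nonneg hC')
  have hle : complexify n A ≤ complexify n B := by
    rw [← sub_nonneg, ← map_sub, complexify_nonneg_iff, sub_nonneg]
    exact hAB
  rw [← sub_nonneg, ← complexify_nonneg_iff, map_sub, map_rpow A hA, map_rpow B (hA.trans hAB),
    sub_nonneg]
  exact CFC.rpow_le_rpow hp hle

end Matrix

lemma symPow_eq_rpow {n : ℕ} {X : Matrix (Fin n) (Fin n) ℝ} (hX : 0 ≤ X) (p : ℝ) :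
    symPow X p = X ^ p := by
  have hH : X.IsHermitian := (nonneg_iff_posSemidef.1 hX).1
  rw [CFC.rpow_eq_cfc_real hX, hH.cfc_eq, symPow, dif_pos hH]
  rfl

lemma posSemidef_fromBlocks_one_iff {n : Type*} [Fintype n] [DecidableEq n]
    {X W : Matrix n n ℝ} (hW : W.IsHermitian) :
    (Matrix.fromBlocks X W W 1).PosSemidef ↔ (X - W ^ 2).PosSemidef := by
  let _ : Invertible (1 : Matrix n n ℝ) := invertibleOne
  have h := Matrix.PosDef.fromBlocks₂₂ X W (Matrix.PosDef.one (n := n) (R := ℝ))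
  rw [hW.eq] at h
  simpa [pow_two] using h

/-- Let `d ≥ 1`.  For every `n ≥ 1` and real symmetric `n × n` matrices
`X ⪰ 0` and `Y`, the following are equivalent:
(i) `X^{1/(2d)} ⪰ Y ⪰ 0`;
(ii) there is a real symmetric `W ⪰ 0` with `X ⪰ W²` and `W^{1/d} ⪰ Y ⪰ 0`;
(iii) there is a real symmetric `W ⪰ 0` with `[[X, W], [W, I]] ⪰ 0` and
`W^{1/d} ⪰ Y ⪰ 0`. -/
theorem even_reciprocal_power_hypograph_sdr (d : ℕ) (hd : 1 ≤ d)
    (n : ℕ) (hn : 1 ≤ n)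
    (X Y : Matrix (Fin n) (Fin n) ℝ) (hX : X.PosSemidef) (hY : Y.IsHermitian) :
    (((symPow X (1 / (2 * (d : ℝ))) - Y).PosSemidef ∧ Y.PosSemidef)
      ↔
    (∃ W : Matrix (Fin n) (Fin n) ℝ, W.IsHermitian ∧ W.PosSemidef ∧
      (X - W ^ 2).PosSemidef ∧
      (symPow W (1 / (d : ℝ)) - Y).PosSemidef ∧ Y.PosSemidef))
    ∧
    (((symPow X (1 / (2 * (d : ℝ))) - Y).PosSemidef ∧ Y.PosSemidef)
      ↔
    (∃ W : Matrix (Fin n) (Fin n) ℝ, W.IsHermitian ∧ W.PosSemidef ∧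
      (Matrix.fromBlocks X W W 1).PosSemidef ∧
      (symPow W (1 / (d : ℝ)) - Y).PosSemidef ∧ Y.PosSemidef)) := by
  have hX0 : 0 ≤ X := nonneg_iff_posSemidef.2 hX
  have hd1 : (1 : ℝ) ≤ d := by exact_mod_cast hd
  have hd0 : (0 : ℝ) < d := by linarith
  have key : ((symPow X (1 / (2 * (d : ℝ))) - Y).PosSemidef ∧ Y.PosSemidef) ↔
      (∃ W : Matrix (Fin n) (Fin n) ℝ, W.IsHermitian ∧ W.PosSemidef ∧
        (X - W ^ 2).PosSemidef ∧
        (symPow W (1 / (d : ℝ)) - Y).PosSemidef ∧ Y.PosSemidef) := by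
    constructor
    · rintro ⟨hXY, hY0⟩
      have hW : 0 ≤ X ^ (1 / 2 : ℝ) := CFC.rpow_nonneg
      refine ⟨X ^ (1 / 2 : ℝ), (nonneg_iff_posSemidef.1 hW).1, nonneg_iff_posSemidef.1 hW,
        ?_, ?_, hY0⟩
      · have hsq : (X ^ (1 / 2 : ℝ)) ^ 2 = X := by
          rw [← CFC.rpow_natCast _ 2 hW,
            CFC.rpow_rpow_of_exponent_nonneg X _ _ (by norm_num) (by norm_num) hX0]
          norm_num
          exact CFC.rpow_one X hX0
        rw [hsq, sub_self]
        exact Matrix.PosSemidef.zero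
      · rw [symPow_eq_rpow hW,
          CFC.rpow_rpow_of_exponent_nonneg X _ _ (by norm_num) (by positivity) hX0,
          one_div_mul_one_div, ← symPow_eq_rpow hX0]
        exact hXY
    · rintro ⟨W, -, hW, hXW, hWY, hY0⟩
      have hW0 : 0 ≤ W := nonneg_iff_posSemidef.2 hW
      have hsq : 0 ≤ W ^ 2 := nonneg_iff_posSemidef.2 (hW.pow 2)
      have hpow : (W ^ 2) ^ (1 / (2 * (d : ℝ))) = W ^ (1 / (d : ℝ)) := by
        rw [← CFC.rpow_natCast W 2 hW0,
          CFC.rpow_rpow_of_exponent_nonneg W _ _ (by norm_num) (by positivity) hW0]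
        congr 1
        push_cast
        field_simp
      have hp : 1 / (2 * (d : ℝ)) ∈ Set.Icc (0 : ℝ) 1 :=
        ⟨by positivity, (div_le_one (by positivity)).2 (by linarith)⟩
      have hle := rpow_le_rpow_of_le hp hsq (Matrix.le_iff.2 hXW)
      rw [hpow, ← symPow_eq_rpow hW0, ← symPow_eq_rpow hX0] at hle
      exact ⟨Matrix.le_iff.1 ((Matrix.le_iff.2 hWY).trans hle), hY0⟩
  refine ⟨key, key.trans (exists_congr fun W => and_congr_right fun hW => ?_)⟩
  rw [posSemidef_fromBlocks_one_iff hW]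
end

section
/- Let p be a rational number with 0 < p < 1/2, and let d = d(p) be the smallest positive integer with d·p ≥ 1/2 (so 1/2 ≤ d·p < 1). For every n ≥ 1 and all real symmetric n×n matrices X and Y with X ⪰ 0, the following are equivalent: (i) X^p ⪰ Y ⪰ 0; (ii) there exists a real symmetric n×n matrix W such that X^{1/d} ⪰ W ⪰ 0 and W^{d·p} ⪰ Y ⪰ 0. -/
open Matrix

theorem symPow_eq_cfc {n : ℕ} {X : Matrix (Fin n) (Fin n) ℝ} (hX : X.IsHermitian) (p : ℝ) :
    symPow X p = cfc (fun x : ℝ => x ^ p) X := by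
  rw [hX.cfc_eq, symPow, dif_pos hX]
  rfl

open scoped MatrixOrder in
theorem posSemidef_symPow {n : ℕ} {X : Matrix (Fin n) (Fin n) ℝ} (hX : X.PosSemidef) (p : ℝ) :
    (symPow X p).PosSemidef := by
  rw [symPow_eq_cfc hX.isHermitian, ← nonneg_iff_posSemidef]
  exact cfc_nonneg fun x hx => Real.rpow_nonneg (spectrum_nonneg_of_nonneg hX.nonneg hx) p

open scoped MatrixOrder in
theorem symPow_symPow {n : ℕ} {X : Matrix (Fin n) (Fin n) ℝ} (hX : X.PosSemidef) (p q : ℝ) :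
    symPow (symPow X p) q = symPow X (p * q) := by
  have hsa : IsSelfAdjoint X := hX.isHermitian
  have hfin : (spectrum ℝ X).Finite := Matrix.finite_real_spectrum
  rw [symPow_eq_cfc (posSemidef_symPow hX p).isHermitian, symPow_eq_cfc hX.isHermitian,
    symPow_eq_cfc hX.isHermitian,
    ← cfc_comp' (fun x : ℝ => x ^ q) (fun x : ℝ => x ^ p) X
      ((hfin.image _).continuousOn _) (hfin.continuousOn _) hsa]
  exact cfc_congr fun x hx =>
    (Real.rpow_mul (spectrum_nonneg_of_nonneg hX.nonneg hx) p q).symm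

/-- Entrywise inclusion of real matrices into complex matrices as a star algebra homomorphism. -/
noncomputable def complexifyMatrix (n : ℕ) :
    Matrix (Fin n) (Fin n) ℝ →⋆ₐ[ℝ] Matrix (Fin n) (Fin n) ℂ :=
  { Complex.ofRealAm.mapMatrix with
    map_star' := fun X => by
      ext i j
      simp [star_eq_conjTranspose] }

theorem complexifyMatrix_apply {n : ℕ} (X : Matrix (Fin n) (Fin n) ℝ) (i j : Fin n) :
    complexifyMatrix n X i j = (X i j : ℂ) := rfl

theorem complexifyMatrix_injective (n : ℕ) : Function.Injective (complexifyMatrix n) :=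
  fun X Y h => by
    ext i j
    exact Complex.ofReal_injective (congrFun (congrFun h i) j)

theorem continuous_complexifyMatrix (n : ℕ) : Continuous (complexifyMatrix n) :=
  continuous_id.matrix_map Complex.continuous_ofReal

open scoped MatrixOrder ComplexOrder in
theorem posSemidef_complexifyMatrix {n : ℕ} {X : Matrix (Fin n) (Fin n) ℝ} :
    (complexifyMatrix n X).PosSemidef ↔ X.PosSemidef := by
  constructor
  · intro h
    refine PosSemidef.of_dotProduct_mulVec_nonneg ?_ fun x => ?_
    · apply complexifyMatrix_injective n
      rw [← star_eq_conjTranspose, map_star]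
      exact h.isHermitian
    · have h1 := h.dotProduct_mulVec_nonneg fun i => (x i : ℂ)
      have h2 : star (fun i => (x i : ℂ)) ⬝ᵥ (complexifyMatrix n X *ᵥ fun i => (x i : ℂ)) =
          ((star x ⬝ᵥ (X *ᵥ x) : ℝ) : ℂ) := by
        simp [dotProduct, mulVec, complexifyMatrix_apply]
      rw [h2] at h1
      exact_mod_cast h1
  · intro h
    obtain ⟨B, rfl⟩ := CStarAlgebra.nonneg_iff_eq_star_mul_self.mp h.nonneg
    rw [map_mul, map_star]
    exact posSemidef_conjTranspose_mul_self _

open scoped MatrixOrder Matrix.Norms.L2Operator in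
/-- The Löwner–Heinz inequality for complex positive semidefinite matrices. -/
theorem cfc_rpow_le_cfc_rpow {n : ℕ} {A B : Matrix (Fin n) (Fin n) ℂ} {q : ℝ}
    (hq : q ∈ Set.Icc (0 : ℝ) 1) (hA : 0 ≤ A) (hAB : A ≤ B) :
    cfc (fun x : ℝ => x ^ q) A ≤ cfc (fun x : ℝ => x ^ q) B := by
  let _ : CStarAlgebra (Matrix (Fin n) (Fin n) ℂ) := {}
  have h := CFC.rpow_le_rpow hq hAB
  rwa [CFC.rpow_eq_cfc_real hA, CFC.rpow_eq_cfc_real (hA.trans hAB)] at h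

theorem complexifyMatrix_symPow {n : ℕ} {X : Matrix (Fin n) (Fin n) ℝ} (hX : X.IsHermitian)
    (q : ℝ) : complexifyMatrix n (symPow X q) = cfc (fun x : ℝ => x ^ q) (complexifyMatrix n X) := by
  have hsa : IsSelfAdjoint X := hX
  rw [symPow_eq_cfc hX]
  exact (complexifyMatrix n).map_cfc _ X (Matrix.finite_real_spectrum.continuousOn _)
    (continuous_complexifyMatrix n) hsa (hsa.map _)

open scoped MatrixOrder ComplexOrder in
/-- The Löwner–Heinz inequality for real positive semidefinite matrices. -/
theorem posSemidef_symPow_sub_symPow {n : ℕ} {A B : Matrix (Fin n) (Fin n) ℝ} {q : ℝ}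
    (hq : q ∈ Set.Icc (0 : ℝ) 1) (hA : A.PosSemidef) (hB : B.PosSemidef)
    (hAB : (B - A).PosSemidef) : (symPow B q - symPow A q).PosSemidef := by
  rw [← posSemidef_complexifyMatrix, map_sub] at hAB ⊢
  rw [complexifyMatrix_symPow hA.isHermitian, complexifyMatrix_symPow hB.isHermitian]
  exact cfc_rpow_le_cfc_rpow hq (posSemidef_complexifyMatrix.mpr hA).nonneg hAB

/-- Let `p` be rational with `0 < p < 1/2` and let `d = d(p)` be the least
positive integer with `d·p ≥ 1/2` (so `1/2 ≤ d·p < 1`).  For every `n ≥ 1`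
and real symmetric `n × n` matrices `X ⪰ 0` and `Y`:
`X^p ⪰ Y ⪰ 0` iff there is a real symmetric `W` with `X^{1/d} ⪰ W ⪰ 0` and
`W^{d·p} ⪰ Y ⪰ 0`. -/
theorem power_hypograph_step_small (p : ℚ) (hp1 : 0 < p) (hp2 : p < 1 / 2)
    (d : ℕ) (hd : 0 < d) (hdp : 1 / 2 ≤ (d : ℚ) * p)
    (hmin : ∀ d' : ℕ, 0 < d' → 1 / 2 ≤ (d' : ℚ) * p → d ≤ d')
    (n : ℕ) (hn : 1 ≤ n)
    (X Y : Matrix (Fin n) (Fin n) ℝ) (hX : X.PosSemidef) (hY : Y.IsHermitian) :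
    ((symPow X (p : ℝ) - Y).PosSemidef ∧ Y.PosSemidef)
      ↔
    (∃ W : Matrix (Fin n) (Fin n) ℝ, W.IsHermitian ∧
      (symPow X (1 / (d : ℝ)) - W).PosSemidef ∧ W.PosSemidef ∧
      (symPow W (((d : ℚ) * p : ℚ) : ℝ) - Y).PosSemidef ∧ Y.PosSemidef) := by
  have hdp0 : (d : ℝ) ≠ 0 := by positivity
  have hlt : (d : ℚ) * p ≤ 1 := by
    rcases Nat.lt_or_ge 1 d with h | h
    · by_contra! hc
      have h1 : (((d - 1 : ℕ) : ℚ)) = d - 1 := by push_cast [h.le]; ring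
      have h2 := hmin (d - 1) (by omega) (by rw [h1]; linarith)
      omega
    · have h1 : (d : ℚ) ≤ 1 := by exact_mod_cast h
      nlinarith
  have hmem : (((d : ℚ) * p : ℚ) : ℝ) ∈ Set.Icc (0 : ℝ) 1 :=
    ⟨by exact_mod_cast (by linarith : (0 : ℚ) ≤ d * p), by exact_mod_cast hlt⟩
  have hcomp : symPow (symPow X (1 / (d : ℝ))) (((d : ℚ) * p : ℚ) : ℝ) = symPow X (p : ℝ) := by
    rw [symPow_symPow hX]
    congr 1
    push_cast
    field_simp
  constructor
  · rintro ⟨h, hY⟩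
    have hW := posSemidef_symPow hX (1 / (d : ℝ))
    exact ⟨symPow X (1 / (d : ℝ)), hW.isHermitian, by simpa using PosSemidef.zero, hW,
      by rwa [hcomp], hY⟩
  · rintro ⟨W, -, hXW, hW, hWY, hY⟩
    refine ⟨?_, hY⟩
    have h := posSemidef_symPow_sub_symPow hmem hW (posSemidef_symPow hX _) hXW
    rw [hcomp] at h
    simpa using h.add hWY
end
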